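/- In the classical Hall algebra H (the Hall algebra of nilpotent representations of the Jordan quiver over F_q, equivalently the Hall algebra of finite modules over the discrete valuation ring F_q[[T]]), for each n ≥ 1 the element p_n = ∑_{λ ⊢ n} (∏_{s=1}^{ℓ(λ)-1}(1-q^s)) [I_λ] is primitive: Δ(p_n) = p_n ⊗ 1 + 1 ⊗ p_n, where I_λ is the module of type λ. -/

import Mathlib

open Finset TensorProduct
open scoped DirectSum

namespace ClassicalHall

/-- Isomorphism classes of finite `F_q[[T]]`-modules are indexed by partitions
(of arbitrary size). -/
def PartIdx : Type := Σ n : ℕ, n.Partition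

/-- The `F[[T]]`-module `I_λ = ⊕ᵢ F[[T]]/(T^{λᵢ})` attached to a partition `λ`. -/
noncomputable def pMod (F : Type) [Field F] (L : PartIdx) : Type :=
  ⨁ _i : Fin ((L.2.parts.sort (· ≤ ·)).length),
    (PowerSeries F ⧸ Ideal.span
      {(PowerSeries.X : PowerSeries F) ^ ((L.2.parts.sort (· ≤ ·)).get _i)})

noncomputable instance (F : Type) [Field F] (L : PartIdx) : AddCommGroup (pMod F L) := by
  unfold pMod; infer_instance

noncomputable instance (F : Type) [Field F] (L : PartIdx) :
    Module (PowerSeries F) (pMod F L) := by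
  unfold pMod; infer_instance

/-- The Hall number `F^{I_L}_{I_μ, I_ν}`: the number of submodules `X ⊆ I_L` with
`X ≅ I_ν` and `I_L/X ≅ I_μ`. -/
noncomputable def hall (F : Type) [Field F] (L μ ν : PartIdx) : ℕ :=
  Nat.card {X : Submodule (PowerSeries F) (pMod F L) //
    Nonempty (X ≃ₗ[PowerSeries F] pMod F ν) ∧
    Nonempty ((pMod F L ⧸ X) ≃ₗ[PowerSeries F] pMod F μ)}

/-- `a_λ = |Aut(I_λ)|`. -/
noncomputable def aut (F : Type) [Field F] (L : PartIdx) : ℕ :=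
  Nat.card (pMod F L ≃ₗ[PowerSeries F] pMod F L)

/-- The classical Hall algebra, as a vector space: the free ℂ-vector space on the
isomorphism classes `[I_λ]`. -/
def H : Type := PartIdx →₀ ℂ

noncomputable instance : AddCommGroup H := by unfold H; infer_instance
noncomputable instance : Module ℂ H := by unfold H; infer_instance

/-- The value of Green's comultiplication on the basis vector `[I_L]`:
`Δ([I_L]) = ∑_{[X],[Y]} (a_X a_Y / a_L) F^{I_L}_{X,Y} [X] ⊗ [Y]`. -/
noncomputable def comulVal (F : Type) [Field F] (L : PartIdx) : H ⊗[ℂ] H :=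
  ∑ k ∈ Finset.range (L.1 + 1), ∑ μ : Nat.Partition k, ∑ ν : Nat.Partition (L.1 - k),
    (((aut F ⟨k, μ⟩ : ℂ) * (aut F ⟨L.1 - k, ν⟩ : ℂ) / (aut F L : ℂ))
        * (hall F L ⟨k, μ⟩ ⟨L.1 - k, ν⟩ : ℂ)) •
      (Finsupp.single (⟨k, μ⟩ : PartIdx) (1 : ℂ) ⊗ₜ[ℂ]
        Finsupp.single (⟨L.1 - k, ν⟩ : PartIdx) (1 : ℂ))

/-- Green's comultiplication `Δ : H → H ⊗ H` of the classical Hall algebra. -/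
noncomputable def comul (F : Type) [Field F] : H →ₗ[ℂ] H ⊗[ℂ] H :=
  Finsupp.lsum ℂ fun L => LinearMap.toSpanSingleton ℂ (H ⊗[ℂ] H) (comulVal F L)

/-- The element `p_n = ∑_{λ ⊢ n} (∏_{s=1}^{ℓ(λ)-1}(1-q^s)) [I_λ]`. -/
noncomputable def pElt (F : Type) [Field F] [Fintype F] (n : ℕ) : H :=
  ∑ lam : n.Partition,
    (∏ s ∈ Finset.Icc 1 (lam.parts.card - 1), (1 - (Fintype.card F : ℂ) ^ s)) •
      Finsupp.single (⟨n, lam⟩ : PartIdx) (1 : ℂ)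

/-- The unit `[0] = [I_∅]` of the Hall algebra. -/
noncomputable def one : H := Finsupp.single (⟨0, Nat.Partition.indiscrete 0⟩ : PartIdx) (1 : ℂ)

section Chains

variable {R V : Type*} [CommRing R] [AddCommGroup V] [Module R V]

/-- The submodules `K` of `V` whose quotient `V ⧸ K` is isomorphic to `M`. -/
abbrev QuotType (R V M : Type*) [CommRing R] [AddCommGroup V] [Module R V]
    [AddCommGroup M] [Module R M] : Type _ :=
  {K : Submodule R V // Nonempty ((V ⧸ K) ≃ₗ[R] M)}

/-- The submodules `X` of `L` of type `N` and cotype `M`. -/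
abbrev HallSet (R L M N : Type*) [CommRing R] [AddCommGroup L] [Module R L]
    [AddCommGroup M] [Module R M] [AddCommGroup N] [Module R N] : Type _ :=
  {X : Submodule R L // Nonempty (X ≃ₗ[R] N) ∧ Nonempty ((L ⧸ X) ≃ₗ[R] M)}

/-- The flags `K₁ ≤ K₂` in `V` with `V ⧸ K₂ ≅ M` and `K₂ ⧸ K₁ ≅ N`. -/
abbrev FlagType (R V M N : Type*) [CommRing R] [AddCommGroup V] [Module R V]
    [AddCommGroup M] [Module R M] [AddCommGroup N] [Module R N] : Type _ :=
  {p : Submodule R V × Submodule R V // p.1 ≤ p.2 ∧ Nonempty ((V ⧸ p.2) ≃ₗ[R] M) ∧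
    Nonempty ((p.2 ⧸ p.1.submoduleOf p.2) ≃ₗ[R] N)}

variable {L M N : Type*} [AddCommGroup L] [Module R L] [AddCommGroup M] [Module R M]
  [AddCommGroup N] [Module R N]

theorem card_surjective_eq :
    Nat.card {f : V →ₗ[R] M // Function.Surjective f} =
      Nat.card (QuotType R V M) * Nat.card (M ≃ₗ[R] M) := by
  rw [← Nat.card_prod]
  symm
  let e : ∀ K : QuotType R V M, (V ⧸ K.1) ≃ₗ[R] M := fun K => K.2.some
  have hker : ∀ (K : QuotType R V M) (a : M ≃ₗ[R] M),
      LinearMap.ker ((((e K).trans a : (V ⧸ K.1) ≃ₗ[R] M) : (V ⧸ K.1) →ₗ[R] M) ∘ₗ K.1.mkQ)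
        = K.1 := by
    intro K a
    rw [LinearEquiv.ker_comp, Submodule.ker_mkQ]
  refine Nat.card_congr (Equiv.ofBijective
    (fun x : QuotType R V M × (M ≃ₗ[R] M) =>
      (⟨(((e x.1).trans x.2 : (V ⧸ x.1.1) ≃ₗ[R] M) : (V ⧸ x.1.1) →ₗ[R] M) ∘ₗ x.1.1.mkQ, ?_⟩ :
        {f : V →ₗ[R] M // Function.Surjective f})) ⟨?_, ?_⟩)
  · exact ((e x.1).trans x.2).surjective.comp (Submodule.mkQ_surjective _)
  · rintro ⟨K, a⟩ ⟨K', a'⟩ h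
    have h' := congrArg Subtype.val h
    have hK : K = K' := by
      apply Subtype.ext
      rw [← hker K a, ← hker K' a']
      exact congrArg LinearMap.ker h'
    subst hK
    congr 1
    ext y
    obtain ⟨z, hz⟩ := ((e K).surjective.comp (Submodule.mkQ_surjective _)) y
    have := LinearMap.congr_fun h' z
    simp only [LinearMap.comp_apply, LinearEquiv.coe_coe, LinearEquiv.trans_apply,
      Function.comp_apply] at this hz
    rwa [hz] at this
  · rintro ⟨f, hf⟩
    let K : QuotType R V M := ⟨LinearMap.ker f, ⟨f.quotKerEquivOfSurjective hf⟩⟩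
    refine ⟨⟨K, (e K).symm.trans (f.quotKerEquivOfSurjective hf)⟩, ?_⟩
    apply Subtype.ext
    ext v
    simp [K]

theorem finite_quotType [Finite (V →ₗ[R] M)] : Finite (QuotType R V M) := by
  refine Finite.of_surjective (fun f : {f : V →ₗ[R] M // Function.Surjective f} =>
    (⟨LinearMap.ker f.1, ⟨f.1.quotKerEquivOfSurjective f.2⟩⟩ : QuotType R V M)) ?_
  rintro ⟨K, ⟨e⟩⟩
  refine ⟨⟨(e : (V ⧸ K) →ₗ[R] M) ∘ₗ K.mkQ, e.surjective.comp (Submodule.mkQ_surjective _)⟩, ?_⟩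
  apply Subtype.ext
  change LinearMap.ker _ = K
  rw [LinearEquiv.ker_comp, Submodule.ker_mkQ]

theorem card_flagType_eq_mul (hV : ∀ K : QuotType R V M, Nonempty (K.1 ≃ₗ[R] V)) :
    Nat.card (FlagType R V M N) = Nat.card (QuotType R V M) * Nat.card (QuotType R V N) := by
  rw [← Nat.card_prod]
  symm
  let e : ∀ K : QuotType R V M, K.1 ≃ₗ[R] V := fun K => (hV K).some
  have hsub : ∀ (K : QuotType R V M) (Z : Submodule R V),
      ((Z.map ((e K).symm : V →ₗ[R] K.1)).map K.1.subtype).submoduleOf K.1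
        = Z.map ((e K).symm : V →ₗ[R] K.1) := by
    intro K Z
    exact Submodule.comap_map_eq_of_injective K.1.injective_subtype _
  refine Nat.card_congr (Equiv.ofBijective
    (fun x : QuotType R V M × QuotType R V N =>
      (⟨((x.2.1.map ((e x.1).symm : V →ₗ[R] x.1.1)).map x.1.1.subtype, x.1.1), ?_⟩ :
        FlagType R V M N)) ⟨?_, ?_⟩)
  · refine ⟨Submodule.map_subtype_le _ _, x.1.2, ?_⟩
    obtain ⟨g⟩ := x.2.2
    exact ⟨(Submodule.quotEquivOfEq _ _ (hsub x.1 x.2.1)).trans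
      ((Submodule.Quotient.equiv _ _ (e x.1).symm rfl).symm.trans g)⟩
  · rintro ⟨K, Z⟩ ⟨K', Z'⟩ h
    have h' := congrArg Subtype.val h
    have hK : K = K' := Subtype.ext (congrArg Prod.snd h')
    subst hK
    have h1 := congrArg Prod.fst h'
    have h2 := Submodule.map_injective_of_injective K.1.injective_subtype h1
    have h3 := Submodule.map_injective_of_injective (e K).symm.injective h2
    exact congrArg (Prod.mk K) (Subtype.ext h3)
  · rintro ⟨⟨K, K'⟩, hle, hM, ⟨g⟩⟩
    let K₁ : QuotType R V M := ⟨K', hM⟩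
    let Z : Submodule R V := (K.submoduleOf K').map ((e K₁ : K' ≃ₗ[R] V) : K' →ₗ[R] V)
    refine ⟨⟨K₁, ⟨Z, ⟨(Submodule.Quotient.equiv _ _ (e K₁) rfl).symm.trans g⟩⟩⟩, ?_⟩
    apply Subtype.ext
    refine Prod.ext ?_ rfl
    change Submodule.map K'.subtype (Submodule.map ((e K₁).symm : V →ₗ[R] K') Z) = K
    have : Submodule.map ((e K₁).symm : V →ₗ[R] K') Z = K.submoduleOf K' := by
      simp only [Z]
      rw [← Submodule.map_comp]
      convert Submodule.map_id _
      ext x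
      simp [K₁]
    rw [this, Submodule.submoduleOf, Submodule.map_comap_subtype]
    exact inf_eq_right.mpr hle

/-- For a surjection `g : V → L`, the quotient of `V` by the preimage of `X` is `L ⧸ X`. -/
noncomputable def quotComapEquiv (g : V →ₗ[R] L) (hg : Function.Surjective g)
    (X : Submodule R L) : (V ⧸ X.comap g) ≃ₗ[R] (L ⧸ X) :=
  (Submodule.quotEquivOfEq _ _ (by rw [LinearMap.ker_comp, Submodule.ker_mkQ])).trans
    ((X.mkQ ∘ₗ g).quotKerEquivOfSurjective ((Submodule.mkQ_surjective _).comp hg))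

/-- For a surjection `g : V → L`, the quotient of the preimage of `X` by the kernel is `X`. -/
noncomputable def comapQuotKerEquiv (g : V →ₗ[R] L) (hg : Function.Surjective g)
    (X : Submodule R L) :
    (X.comap g ⧸ (LinearMap.ker g).submoduleOf (X.comap g)) ≃ₗ[R] X :=
  (Submodule.quotEquivOfEq _ _ (by
    ext v
    simp [Submodule.submoduleOf, Subtype.ext_iff])).trans
    ((g.submoduleComap X).quotKerEquivOfSurjective
      (g.submoduleComap_surjective_of_surjective X hg))

theorem card_flagType_eq_sum {ι : Type*} [Fintype ι] (L : ι → Type*)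
    [∀ i, AddCommGroup (L i)] [∀ i, Module R (L i)]
    [∀ i, Finite (QuotType R V (L i))] [∀ i, Finite (L i)]
    (huniq : ∀ i j, Nonempty (L i ≃ₗ[R] L j) → i = j)
    (hex : ∀ p : FlagType R V M N, ∃ i, Nonempty ((V ⧸ p.1.1) ≃ₗ[R] L i)) :
    Nat.card (FlagType R V M N) =
      ∑ i, Nat.card (QuotType R V (L i)) * Nat.card (HallSet R (L i) M N) := by
  simp_rw [← Nat.card_prod]
  rw [← Nat.card_sigma]
  symm
  let g : ∀ (i : ι) (K : QuotType R V (L i)), V →ₗ[R] L i :=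
    fun i K => (K.2.some : (V ⧸ K.1) →ₗ[R] L i) ∘ₗ K.1.mkQ
  have hg : ∀ i K, Function.Surjective (g i K) := fun i K =>
    K.2.some.surjective.comp (Submodule.mkQ_surjective _)
  have hker : ∀ i K, LinearMap.ker (g i K) = K.1 := by
    intro i K
    simp only [g]
    rw [LinearEquiv.ker_comp, Submodule.ker_mkQ]
  refine Nat.card_congr (Equiv.ofBijective
    (fun x : Σ i, QuotType R V (L i) × HallSet R (L i) M N =>
      (⟨(LinearMap.ker (g x.1 x.2.1), x.2.2.1.comap (g x.1 x.2.1)), ?_⟩ :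
        FlagType R V M N)) ⟨?_, ?_⟩)
  · obtain ⟨⟨e₁⟩, ⟨e₂⟩⟩ := x.2.2.2
    exact ⟨LinearMap.ker_le_comap _, ⟨(quotComapEquiv _ (hg _ _) _).trans e₂⟩,
      ⟨(comapQuotKerEquiv _ (hg _ _) _).trans e₁⟩⟩
  · rintro ⟨i, K, X⟩ ⟨j, K', X'⟩ h
    have h' := congrArg Subtype.val h
    have hK : K.1 = K'.1 := by
      rw [← hker i K, ← hker j K']
      exact congrArg Prod.fst h'
    have hij : i = j := huniq i j
      ⟨K.2.some.symm.trans ((Submodule.quotEquivOfEq _ _ hK).trans K'.2.some)⟩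
    subst hij
    have hKK : K = K' := Subtype.ext hK
    subst hKK
    have hX : X.1.comap (g i K) = X'.1.comap (g i K) := congrArg Prod.snd h'
    rw [Subtype.ext (Submodule.comap_injective_of_surjective (hg i K) hX)]
  · rintro ⟨⟨K, K'⟩, hle, ⟨e₂⟩, ⟨e₁⟩⟩
    obtain ⟨i, hi⟩ := hex ⟨⟨K, K'⟩, hle, ⟨e₂⟩, ⟨e₁⟩⟩
    let K₁ : QuotType R V (L i) := ⟨K, hi⟩
    have hk₁ : LinearMap.ker (g i K₁) = K := hker i K₁
    have hcm : (K'.map (g i K₁)).comap (g i K₁) = K' := by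
      rw [Submodule.comap_map_eq, hk₁]
      exact sup_eq_left.mpr hle
    have hsub : (LinearMap.ker (g i K₁)).submoduleOf K' = K.submoduleOf K' := by rw [hk₁]
    have E₁ := comapQuotKerEquiv _ (hg i K₁) (K'.map (g i K₁))
    have E₂ := quotComapEquiv _ (hg i K₁) (K'.map (g i K₁))
    rw [hcm] at E₁ E₂
    refine ⟨⟨i, K₁, ⟨K'.map (g i K₁), ⟨E₁.symm.trans
      ((Submodule.quotEquivOfEq _ _ hsub).trans e₁)⟩, ⟨E₂.symm.trans e₂⟩⟩⟩, ?_⟩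
    exact Subtype.ext (Prod.ext hk₁ hcm)

end Chains

section Cyclic

open PowerSeries

variable (F : Type) [Field F]

/-- The cyclic module `F[[T]]/(T^k)`. -/
abbrev Cyc (k : ℕ) : Type := F⟦X⟧ ⧸ Ideal.span {(X : F⟦X⟧) ^ k}

variable {F}

/-- Reading off the first `k` coefficients identifies `F[[T]]/(T^k)` with `F^k` as a set. -/
theorem nonempty_cyc_equiv (k : ℕ) : Nonempty (Cyc F k ≃ (Fin k → F)) := by
  let c : F⟦X⟧ →+ (Fin k → F) :=
    { toFun := fun f i => coeff i.1 f
      map_zero' := by ext; simp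
      map_add' := by intros; ext; simp }
  have hker : ∀ f, f ∈ Ideal.span {(X : F⟦X⟧) ^ k} ↔ c f = 0 := by
    intro f
    rw [Ideal.mem_span_singleton, X_pow_dvd_iff, funext_iff]
    exact ⟨fun h i => h i i.2, fun h m hm => h ⟨m, hm⟩⟩
  have hmk : ∀ f g, (Ideal.Quotient.mk (Ideal.span {(X : F⟦X⟧) ^ k}) f = Ideal.Quotient.mk _ g)
      ↔ c f = c g := by
    intro f g
    rw [Ideal.Quotient.mk_eq_mk_iff_sub_mem, hker, map_sub, sub_eq_zero]
  refine ⟨Equiv.ofBijective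
    (fun x => c (Function.surjInv Ideal.Quotient.mk_surjective x)) ⟨?_, ?_⟩⟩
  · intro x y h
    rw [← Function.surjInv_eq Ideal.Quotient.mk_surjective x,
      ← Function.surjInv_eq Ideal.Quotient.mk_surjective y]
    exact (hmk _ _).mpr h
  · intro v
    let f : F⟦X⟧ := PowerSeries.mk fun i => if h : i < k then v ⟨i, h⟩ else 0
    refine ⟨Ideal.Quotient.mk _ f, ?_⟩
    have : c f = v := by
      ext i
      simp [c, f]
    rw [← this]
    exact (hmk _ _).mp (Function.surjInv_eq _ _)

theorem card_cyc [Fintype F] (k : ℕ) : Nat.card (Cyc F k) = Fintype.card F ^ k := by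
  rw [Nat.card_congr (nonempty_cyc_equiv (F := F) k).some]
  simp

instance [Finite F] (k : ℕ) : Finite (Cyc F k) :=
  Finite.of_equiv _ (nonempty_cyc_equiv (F := F) k).some.symm

theorem card_range_smul_cyc [Fintype F] (i k : ℕ) :
    Nat.card (Set.range fun x : Cyc F k => (X : F⟦X⟧) ^ i • x) = Fintype.card F ^ (k - i) := by
  let g : F⟦X⟧ →ₗ[F⟦X⟧] Cyc F k :=
    LinearMap.lsmul F⟦X⟧ (Cyc F k) (X ^ i) ∘ₗ Submodule.mkQ (Ideal.span {(X : F⟦X⟧) ^ k})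
  have hr : (Set.range fun x : Cyc F k => (X : F⟦X⟧) ^ i • x) = (LinearMap.range g : Set _) := by
    rw [LinearMap.coe_range, LinearMap.coe_comp,
      (Submodule.mkQ_surjective (Ideal.span {(X : F⟦X⟧) ^ k})).range_comp]
    rfl
  have hk : LinearMap.ker g = Ideal.span {(X : F⟦X⟧) ^ (k - i)} := by
    ext f
    have h1 : g f = Submodule.Quotient.mk (X ^ i * f) := rfl
    rw [LinearMap.mem_ker, h1, Submodule.Quotient.mk_eq_zero]
    rw [Ideal.mem_span_singleton, Ideal.mem_span_singleton]
    rcases le_total i k with h | h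
    · obtain ⟨j, rfl⟩ := Nat.exists_eq_add_of_le h
      rw [Nat.add_sub_cancel_left, pow_add]
      exact mul_dvd_mul_iff_left (pow_ne_zero _ X_ne_zero)
    · rw [Nat.sub_eq_zero_of_le h]
      simp only [pow_zero, isUnit_one, IsUnit.dvd, iff_true]
      exact Dvd.dvd.mul_right (pow_dvd_pow _ h) _
  rw [hr, ← card_cyc]
  exact Nat.card_congr ((Submodule.quotEquivOfEq _ _ hk).symm.trans
    g.quotKerEquivRange).symm.toEquiv

theorem card_pi_cyc [Fintype F] {ι : Type*} [Fintype ι] (k : ι → ℕ) :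
    Nat.card (∀ i, Cyc F (k i)) = Fintype.card F ^ ∑ i, k i := by
  rw [Nat.card_pi, ← Finset.prod_pow_eq_pow_sum]
  exact Finset.prod_congr rfl fun i _ => card_cyc _

theorem card_range_smul_pi_cyc [Fintype F] {ι : Type*} [Fintype ι] (k : ι → ℕ) (i : ℕ) :
    Nat.card (Set.range fun x : ∀ j, Cyc F (k j) => (X : F⟦X⟧) ^ i • x)
      = Fintype.card F ^ ∑ j, (k j - i) := by
  have : (Set.range fun x : ∀ j, Cyc F (k j) => (X : F⟦X⟧) ^ i • x)
      = Set.univ.pi fun j => Set.range fun x : Cyc F (k j) => (X : F⟦X⟧) ^ i • x :=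
    Set.range_piMap (fun j (x : Cyc F (k j)) => (X : F⟦X⟧) ^ i • x)
  rw [this, Nat.card_congr (Equiv.Set.univPi _), Nat.card_pi, ← Finset.prod_pow_eq_pow_sum]
  exact Finset.prod_congr rfl fun j _ => card_range_smul_cyc _ _

theorem card_range_smul_congr {R M N : Type*} [CommRing R] [AddCommGroup M] [Module R M]
    [AddCommGroup N] [Module R N] (e : M ≃ₗ[R] N) (r : R) :
    Nat.card (Set.range fun x : M => r • x) = Nat.card (Set.range fun x : N => r • x) := by
  have : (Set.range fun x : N => r • x) = e '' (Set.range fun x : M => r • x) := by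
    rw [← Set.range_comp, ← e.surjective.range_comp]
    congr 1
    ext x
    simp
  rw [this]
  exact (Nat.card_image_of_injective e.injective _).symm

/-- The second differences of `i ↦ ∑ (x - i)` count the occurrences of `i`. -/
theorem sum_map_sub_add (s : Multiset ℕ) (i : ℕ) :
    (s.map (· - i)).sum + (s.map (· - (i + 2))).sum =
      2 * (s.map (· - (i + 1))).sum + s.count (i + 1) := by
  induction s using Multiset.induction_on with
  | empty => simp
  | cons a s ih =>
    simp only [Multiset.map_cons, Multiset.sum_cons, Multiset.count_cons]
    split_ifs with h <;> omega

theorem eq_of_sum_map_sub_eq {s t : Multiset ℕ} (hs : ∀ x ∈ s, 0 < x) (ht : ∀ x ∈ t, 0 < x)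
    (h : ∀ i, (s.map (· - i)).sum = (t.map (· - i)).sum) : s = t := by
  ext i
  cases i with
  | zero =>
    rw [Multiset.count_eq_zero_of_notMem fun h => (hs 0 h).false,
      Multiset.count_eq_zero_of_notMem fun h => (ht 0 h).false]
  | succ i =>
    have h1 := sum_map_sub_add s i
    have h2 := sum_map_sub_add t i
    rw [h, h, h] at h1
    omega

theorem map_univ_eq_of_pi_cyc_equiv [Finite F] {ι κ : Type*} [Fintype ι] [Fintype κ]
    {k : ι → ℕ} {l : κ → ℕ} (hk : ∀ i, 0 < k i) (hl : ∀ i, 0 < l i)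
    (e : (∀ i, Cyc F (k i)) ≃ₗ[F⟦X⟧] ∀ i, Cyc F (l i)) :
    Finset.univ.val.map k = Finset.univ.val.map l := by
  have := Fintype.ofFinite F
  refine eq_of_sum_map_sub_eq (by simpa using hk) (by simpa using hl) fun i => ?_
  have h := card_range_smul_congr e ((X : F⟦X⟧) ^ i)
  rw [card_range_smul_pi_cyc, card_range_smul_pi_cyc] at h
  simpa using Nat.pow_right_injective Fintype.one_lt_card h

theorem exists_equiv_of_map_univ_eq {ι κ α : Type*} [Fintype ι] [Fintype κ] {k : ι → α}
    {l : κ → α} (h : Finset.univ.val.map k = Finset.univ.val.map l) :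
    ∃ e : ι ≃ κ, ∀ i, l (e i) = k i := by
  classical
  have hcard : ∀ v, Fintype.card {i // k i = v} = Fintype.card {j // l j = v} := by
    intro v
    have h1 := congrArg (Multiset.count v) h
    simp only [Multiset.count_map] at h1
    rw [Fintype.card_subtype, Fintype.card_subtype, Finset.card_def, Finset.card_def,
      Finset.filter_val, Finset.filter_val]
    simpa only [eq_comm] using h1
  let e : ι ≃ κ := (Equiv.sigmaFiberEquiv k).symm.trans
    ((Equiv.sigmaCongrRight fun v => Fintype.equivOfCardEq (hcard v)).trans
      (Equiv.sigmaFiberEquiv l))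
  exact ⟨e, fun i => (Fintype.equivOfCardEq (hcard (k i)) ⟨i, rfl⟩).2⟩

instance : Subsingleton (Cyc F 0) :=
  Ideal.Quotient.subsingleton_iff.mpr (by simp)

/-- Cyclic summands that vanish can be dropped, and the others permuted. -/
theorem nonempty_pi_cyc_equiv {ι κ : Type*} [Fintype ι] [Fintype κ]
    {k : ι → ℕ} {l : κ → ℕ}
    (h : (Finset.univ.val.map k).filter (· ≠ 0) = Finset.univ.val.map l) :
    Nonempty ((∀ i, Cyc F (k i)) ≃ₗ[F⟦X⟧] ∀ i, Cyc F (l i)) := by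
  classical
  have hmap : Finset.univ.val.map (fun i : {i // k i ≠ 0} => k i.1) = Finset.univ.val.map l := by
    rw [← h, Multiset.filter_map]
    exact Finset.univ_val_map_subtype_restrict k fun i => k i ≠ 0
  obtain ⟨e, he⟩ := exists_equiv_of_map_univ_eq hmap
  let g : (∀ i, Cyc F (k i)) →ₗ[F⟦X⟧] ∀ i : {i // k i ≠ 0}, Cyc F (k i.1) :=
    LinearMap.pi fun i => LinearMap.proj i.1
  have hg : Function.Bijective g := by
    constructor
    · intro x y hxy
      ext i
      by_cases hi : k i = 0
      · have : Subsingleton (Cyc F (k i)) := by rw [hi]; infer_instance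
        exact Subsingleton.elim _ _
      · exact congrFun hxy ⟨i, hi⟩
    · intro y
      refine ⟨fun i => if hi : k i ≠ 0 then y ⟨i, hi⟩ else 0, ?_⟩
      ext ⟨i, hi⟩
      exact dif_pos hi
  exact ⟨(LinearEquiv.ofBijective g hg).trans
    ((LinearEquiv.piCongrRight fun i => Submodule.quotEquivOfEq _ _ (by rw [he i])).trans
      (LinearEquiv.piCongrLeft F⟦X⟧ (fun j => Cyc F (l j)) e))⟩

/-- A finite `F[[T]]`-module is a product of cyclic modules `F[[T]]/(T^k)`. -/
theorem exists_equiv_pi_cyc (M : Type*) [AddCommGroup M] [Module F⟦X⟧ M] [Finite M] :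
    ∃ (d : ℕ) (k : Fin d → ℕ), Nonempty (M ≃ₗ[F⟦X⟧] ∀ i, Cyc F (k i)) := by
  have htors : Module.IsTorsion' M (Submonoid.powers (X : F⟦X⟧)) := by
    intro x
    obtain ⟨i, j, hij, h⟩ := Finite.exists_ne_map_eq_of_infinite
      (fun i : ℕ => (X : F⟦X⟧) ^ i • x)
    wlog hlt : i < j generalizing i j
    · exact this j i hij.symm h.symm (lt_of_le_of_ne (not_lt.mp hlt) hij.symm)
    obtain ⟨d, rfl⟩ := Nat.exists_eq_add_of_lt hlt
    refine ⟨⟨X ^ i, i, rfl⟩, ?_⟩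
    have hu : IsUnit (1 - (X : F⟦X⟧) ^ (d + 1)) := by
      rw [isUnit_iff_constantCoeff]
      simp
    change (X : F⟦X⟧) ^ i • x = 0
    have h0 : (1 - (X : F⟦X⟧) ^ (d + 1)) • (X : F⟦X⟧) ^ i • x = 0 := by
      rw [sub_smul, one_smul, smul_smul, ← pow_add, sub_eq_zero]
      refine h.trans ?_
      congr 2
      ring
    exact (hu.smul_eq_zero).mp h0
  obtain ⟨d, k, ⟨e⟩⟩ := Module.torsion_by_prime_power_decomposition
    (PowerSeries.X_prime (R := F)).irreducible htors
  exact ⟨d, k, ⟨e.trans (DirectSum.linearEquivFunOnFintype F⟦X⟧ (Fin d)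
    (fun i => Cyc F (k i)))⟩⟩

end Cyclic

section Surjections

open PowerSeries

variable {F : Type} [Field F]

theorem nonempty_submodule_equiv_of_finite_quotient {m : ℕ}
    (K : Submodule F⟦X⟧ (Fin m → F⟦X⟧)) [Finite ((Fin m → F⟦X⟧) ⧸ K)] :
    Nonempty (K ≃ₗ[F⟦X⟧] (Fin m → F⟦X⟧)) := by
  have hinf : Infinite F⟦X⟧ := by
    refine Infinite.of_injective (fun n : ℕ => (X : F⟦X⟧) ^ n) fun a b hab => ?_
    have := congrArg PowerSeries.order hab
    simpa [PowerSeries.order_X_pow] using this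
  have htors : Module.IsTorsion F⟦X⟧ ((Fin m → F⟦X⟧) ⧸ K) := by
    intro x
    obtain ⟨a, b, hab, h⟩ := Finite.exists_ne_map_eq_of_infinite (fun r : F⟦X⟧ => r • x)
    refine ⟨⟨a - b, mem_nonZeroDivisors_of_ne_zero (sub_ne_zero.mpr hab)⟩, ?_⟩
    change (a - b) • x = 0
    rw [sub_smul, sub_eq_zero]
    exact h
  have hfin := Submodule.finrank_quotient_add_finrank K
  rw [Module.finrank_eq_zero_iff_isTorsion.mpr htors, zero_add, Module.finrank_fin_fun] at hfin
  exact ⟨(Module.finBasisOfFinrankEq F⟦X⟧ K hfin).equivFun⟩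

theorem span_range_eq_top_iff_linearIndependent {m l : ℕ} (w : Fin m → Fin l → F) :
    Submodule.span F (Set.range w) = ⊤ ↔ LinearIndependent F (fun i j => w j i) := by
  have h1 := Matrix.rank_eq_finrank_span_row (Matrix.of w)
  have h2 := Matrix.rank_eq_finrank_span_cols (Matrix.of w)
  have h3 : (Matrix.of w).row = w := rfl
  have h4 : (Matrix.of w).col = fun i j => w j i := rfl
  rw [h3] at h1
  rw [h4] at h2
  rw [linearIndependent_iff_card_eq_finrank_span, Set.finrank, ← h2, h1, Fintype.card_fin]
  constructor
  · intro h
    rw [h, finrank_top, Module.finrank_fin_fun]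
  · intro h
    apply Submodule.eq_top_of_finrank_eq
    rw [← h, Module.finrank_fin_fun]

theorem card_spanning [Fintype F] {m l : ℕ} (h : l ≤ m) :
    Nat.card {w : Fin m → Fin l → F // Submodule.span F (Set.range w) = ⊤} =
      ∏ s : Fin l, (Fintype.card F ^ m - Fintype.card F ^ s.1) := by
  have := card_linearIndependent (K := F) (V := Fin m → F) (k := l) (by simpa using h)
  rw [Module.finrank_fin_fun] at this
  rw [← this]
  exact Nat.card_congr ((Equiv.piComm _).subtypeEquiv fun w =>
    span_range_eq_top_iff_linearIndependent w)

/-- The constant coefficient of a class in `F[[T]]/(T^k)` with `k` positive. -/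
noncomputable def cycConst {k : ℕ} (hk : 0 < k) : Cyc F k →+* F :=
  Ideal.Quotient.lift _ (constantCoeff (R := F)) (by
    intro a ha
    rw [Ideal.mem_span_singleton] at ha
    exact X_dvd_iff.mp ((dvd_pow_self _ hk.ne').trans ha))

/-- The reduction modulo `T` of a product of nonzero cyclic modules. -/
noncomputable def cycRed {ι : Type*} {k : ι → ℕ} (hk : ∀ i, 0 < k i) :
    (∀ i, Cyc F (k i)) →ₛₗ[constantCoeff (R := F)] (ι → F) where
  toFun x i := cycConst (hk i) (x i)
  map_add' x y := by ext; simp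
  map_smul' r x := by
    ext i
    obtain ⟨f, hf⟩ := Ideal.Quotient.mk_surjective (x i)
    simp only [Pi.smul_apply, ← hf, smul_eq_mul]
    rw [← Ideal.Quotient.mk_eq_mk, ← Submodule.Quotient.mk_smul]
    exact map_mul constantCoeff r f

instance : RingHomSurjective (constantCoeff (R := F)) := ⟨constantCoeff_surj⟩

theorem cycRed_surjective {ι : Type*} {k : ι → ℕ} (hk : ∀ i, 0 < k i) :
    Function.Surjective (cycRed (F := F) hk) := by
  intro w
  refine ⟨fun i => Ideal.Quotient.mk _ (C (w i)), ?_⟩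
  ext i
  exact constantCoeff_C (w i)

theorem ker_cycRed_le {ι : Type*} {k : ι → ℕ} (hk : ∀ i, 0 < k i) :
    LinearMap.ker (cycRed (F := F) hk) ≤ Ideal.span {(X : F⟦X⟧)} • ⊤ := by
  intro x hx
  have : ∀ i, ∃ y : Cyc F (k i), (X : F⟦X⟧) • y = x i := by
    intro i
    have hxi : cycConst (hk i) (x i) = 0 := congrFun hx i
    obtain ⟨f, hf⟩ := Ideal.Quotient.mk_surjective (x i)
    rw [← hf] at hxi ⊢
    obtain ⟨g, rfl⟩ := X_dvd_iff.mpr hxi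
    exact ⟨Ideal.Quotient.mk _ g, rfl⟩
  choose y hy using this
  have : x = (X : F⟦X⟧) • y := by
    ext i
    exact (hy i).symm
  rw [this]
  exact Submodule.smul_mem_smul (Ideal.mem_span_singleton_self _) trivial

/-- Nakayama's lemma for products of cyclic modules. -/
theorem span_eq_top_iff_cycRed [Finite F] {ι κ : Type*} [Finite ι] {k : ι → ℕ}
    (hk : ∀ i, 0 < k i) (v : κ → ∀ i, Cyc F (k i)) :
    Submodule.span F⟦X⟧ (Set.range v) = ⊤ ↔
      Submodule.span F (Set.range fun j => cycRed hk (v j)) = ⊤ := by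
  have hmap : Submodule.span F (Set.range fun j => cycRed hk (v j)) =
      (Submodule.span F⟦X⟧ (Set.range v)).map (cycRed hk) := by
    rw [Submodule.map_span, ← Set.range_comp]
    rfl
  rw [hmap]
  constructor
  · intro h
    rw [h, Submodule.map_top, LinearMap.range_eq_top]
    exact cycRed_surjective hk
  · intro h
    rw [eq_top_iff]
    apply Submodule.le_of_le_smul_of_le_jacobson_bot (I := Ideal.span {(X : F⟦X⟧)})
      (Module.Finite.fg_top)
    · rw [IsLocalRing.jacobson_eq_maximalIdeal ⊥ bot_ne_top, Ideal.span_le,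
        Set.singleton_subset_iff]
      exact (IsLocalRing.mem_maximalIdeal _).mpr X_prime.not_isUnit
    · intro x _
      have hx : cycRed hk x ∈ (Submodule.span F⟦X⟧ (Set.range v)).map (cycRed hk) := by
        rw [h]
        trivial
      obtain ⟨y, hy, hyx⟩ := hx
      have hmem : x - y ∈ LinearMap.ker (cycRed (F := F) hk) := by
        rw [LinearMap.mem_ker, map_sub, hyx, sub_self]
      have := Submodule.add_mem_sup hy (ker_cycRed_le hk hmem)
      rwa [add_sub_cancel] at this

/-- As a set, a product of cyclic modules is the product of its reduction modulo `T` and the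
kernel of the reduction. -/
theorem exists_equiv_prod_ker {ι : Type*} {k : ι → ℕ} (hk : ∀ i, 0 < k i) :
    ∃ e : (∀ i, Cyc F (k i)) ≃ (ι → F) × LinearMap.ker (cycRed (F := F) hk),
      ∀ x, (e x).1 = cycRed hk x := by
  let s := Function.surjInv (cycRed_surjective (F := F) hk)
  have hs : ∀ w, cycRed hk (s w) = w := Function.surjInv_eq _
  refine ⟨
    { toFun := fun x => (cycRed hk x, ⟨x - s (cycRed hk x), by
        rw [LinearMap.mem_ker, map_sub, hs, sub_self]⟩)
      invFun := fun p => s p.1 + p.2.1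
      left_inv := fun x => by simp
      right_inv := ?_ }, fun x => rfl⟩
  rintro ⟨w, y, hy⟩
  have : cycRed hk (s w + y) = w := by
    rw [map_add, hs, LinearMap.mem_ker.mp hy, add_zero]
  ext1
  · exact this
  · apply Subtype.ext
    change s w + y - s (cycRed hk (s w + y)) = y
    rw [this, add_sub_cancel_left]

theorem card_surjective_eq_card_span {R M : Type*} [CommRing R] [AddCommGroup M] [Module R M]
    (m : ℕ) :
    Nat.card {f : (Fin m → R) →ₗ[R] M // Function.Surjective f} =
      Nat.card {v : Fin m → M // Submodule.span R (Set.range v) = ⊤} := by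
  refine (Nat.card_congr ((((Pi.basisFun R (Fin m)).constr ℕ).toEquiv).subtypeEquiv
    fun v => ?_)).symm
  change _ ↔ Function.Surjective ((Pi.basisFun R (Fin m)).constr ℕ v)
  rw [← LinearMap.range_eq_top, Module.Basis.constr_range]

theorem card_surjective_pi_cyc [Fintype F] {m l : ℕ} (h : l ≤ m) {k : Fin l → ℕ}
    (hk : ∀ i, 0 < k i) :
    (Nat.card {f : (Fin m → F⟦X⟧) →ₗ[F⟦X⟧] (∀ i, Cyc F (k i)) // Function.Surjective f} : ℂ) =
      ((Fintype.card F : ℂ) ^ m) ^ (∑ i, k i) *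
        ∏ s ∈ Finset.range l, (1 - (Fintype.card F : ℂ) ^ s * ((Fintype.card F : ℂ) ^ m)⁻¹) := by
  obtain ⟨K, e, he⟩ : ∃ (K : Type) (e : (∀ i, Cyc F (k i)) ≃ (Fin l → F) × K),
      ∀ x, (e x).1 = cycRed hk x := ⟨_, exists_equiv_prod_ker hk⟩
  have hcard : Nat.card {f : (Fin m → F⟦X⟧) →ₗ[F⟦X⟧] (∀ i, Cyc F (k i)) //
      Function.Surjective f} =
      (∏ s : Fin l, (Fintype.card F ^ m - Fintype.card F ^ s.1)) * Nat.card K ^ m := by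
    rw [card_surjective_eq_card_span, ← card_spanning h]
    have : Nat.card K ^ m = Nat.card (Fin m → K) := by simp [Nat.card_pi]
    rw [this, ← Nat.card_prod]
    let E : (Fin m → ∀ i, Cyc F (k i)) ≃ (Fin m → Fin l → F) × (Fin m → K) :=
      (Equiv.piCongrRight fun _ => e).trans (Equiv.arrowProdEquivProdArrow _ _ _)
    refine Nat.card_congr ((E.subtypeEquiv
      (q := fun p => Submodule.span F (Set.range p.1) = ⊤) fun v => ?_).trans
      (Equiv.prodSubtypeFstEquivSubtypeProd
        (p := fun w : Fin m → Fin l → F => Submodule.span F (Set.range w) = ⊤)))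
    rw [span_eq_top_iff_cycRed hk]
    have : (E v).1 = fun j => cycRed hk (v j) := funext fun j => he (v j)
    rw [this]
  have hM : (Fintype.card F : ℂ) ^ (∑ i, k i) = (Fintype.card F : ℂ) ^ l * (Nat.card K : ℂ) := by
    have h1 := Nat.card_congr e
    rw [card_pi_cyc, Nat.card_prod] at h1
    simp at h1
    exact_mod_cast h1
  have hq : (Fintype.card F : ℂ) ≠ 0 := by exact_mod_cast Fintype.card_ne_zero
  rw [hcard, ← pow_mul, mul_comm m, pow_mul, hM, mul_pow, Nat.cast_mul, Nat.cast_prod,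
    Nat.cast_pow, ← pow_mul, mul_comm l, pow_mul, mul_right_comm]
  congr 1
  rw [Finset.prod_range fun s => (1 - (Fintype.card F : ℂ) ^ s * ((Fintype.card F : ℂ) ^ m)⁻¹)]
  have : ((Fintype.card F : ℂ) ^ m) ^ l = ∏ _s : Fin l, (Fintype.card F : ℂ) ^ m := by simp
  rw [this, ← Finset.prod_mul_distrib]
  refine Finset.prod_congr rfl fun s _ => ?_
  rw [Nat.cast_sub (Nat.pow_le_pow_right Fintype.card_pos (s.2.le.trans h))]
  push_cast
  field_simp

end Surjections

section Partitions

open PowerSeries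

/-- The parts of a partition, in the order used by `pMod`. -/
abbrev partList (L : PartIdx) : List ℕ := L.2.parts.sort (· ≤ ·)

/-- The index of a partition of `n`. -/
def idx {n : ℕ} (lam : n.Partition) : PartIdx := ⟨n, lam⟩

theorem partList_get_pos (L : PartIdx) (i : Fin (partList L).length) :
    0 < (partList L).get i :=
  L.2.parts_pos ((Multiset.mem_sort _).mp (List.get_mem _ i))

theorem map_univ_partList_get (L : PartIdx) :
    Finset.univ.val.map (partList L).get = L.2.parts := by
  rw [Fin.univ_val_map, List.ofFn_get, Multiset.sort_eq]

theorem sum_partList_get (L : PartIdx) : ∑ i, (partList L).get i = L.1 := by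
  rw [Finset.sum, map_univ_partList_get, L.2.parts_sum]

theorem card_parts_le (L : PartIdx) : L.2.parts.card ≤ L.1 := by
  have h := Multiset.card_nsmul_le_sum (s := L.2.parts) (a := 1) fun x hx => L.2.parts_pos hx
  rwa [L.2.parts_sum, smul_eq_mul, mul_one] at h

variable (F : Type) [Field F]

/-- `I_λ` as a finite product of cyclic modules. -/
noncomputable def pModEquiv (L : PartIdx) :
    pMod F L ≃ₗ[F⟦X⟧] ∀ i, Cyc F ((partList L).get i) :=
  DirectSum.linearEquivFunOnFintype F⟦X⟧ _ fun i => Cyc F ((partList L).get i)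

instance [Finite F] (L : PartIdx) : Finite (pMod F L) :=
  Finite.of_equiv _ (pModEquiv F L).symm.toEquiv

theorem card_pMod [Fintype F] (L : PartIdx) : Nat.card (pMod F L) = Fintype.card F ^ L.1 := by
  rw [Nat.card_congr (pModEquiv F L).toEquiv, card_pi_cyc, sum_partList_get]

variable {F}

theorem eq_of_pMod_equiv [Finite F] {n : ℕ} {lam lam' : n.Partition}
    (h : Nonempty (pMod F (idx lam) ≃ₗ[F⟦X⟧] pMod F (idx lam'))) : lam = lam' := by
  obtain ⟨e⟩ := h
  have := map_univ_eq_of_pi_cyc_equiv (partList_get_pos _) (partList_get_pos _)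
    ((pModEquiv F (idx lam)).symm.trans (e.trans (pModEquiv F (idx lam'))))
  rw [map_univ_partList_get, map_univ_partList_get] at this
  exact Nat.Partition.ext this

theorem exists_pMod_equiv [Fintype F] {n : ℕ} (M : Type*) [AddCommGroup M] [Module F⟦X⟧ M]
    [Finite M] (hM : Nat.card M = Fintype.card F ^ n) :
    ∃ lam : n.Partition, Nonempty (M ≃ₗ[F⟦X⟧] pMod F (idx lam)) := by
  obtain ⟨d, k, ⟨e⟩⟩ := exists_equiv_pi_cyc (F := F) M
  have hsum : (Finset.univ.val.map k).sum = n := by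
    rw [Nat.card_congr e.toEquiv, card_pi_cyc] at hM
    exact Nat.pow_right_injective Fintype.one_lt_card hM
  let lam : n.Partition := Nat.Partition.ofSums n _ hsum
  obtain ⟨e'⟩ := nonempty_pi_cyc_equiv (F := F) (k := k) (l := (partList (idx lam)).get)
    (by rw [map_univ_partList_get]; rfl)
  exact ⟨lam, ⟨e.trans (e'.trans (pModEquiv F (idx lam)).symm)⟩⟩

instance {m : ℕ} {R M : Type*} [CommRing R] [AddCommGroup M] [Module R M] [Finite M] :
    Finite ((Fin m → R) →ₗ[R] M) :=
  Finite.of_equiv _ ((Pi.basisFun R (Fin m)).constr ℕ).toEquiv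

theorem card_eq_of_flag {R V M N : Type*} [CommRing R] [AddCommGroup V] [Module R V]
    [AddCommGroup M] [Module R M] [AddCommGroup N] [Module R N] (p : FlagType R V M N) :
    Nat.card (V ⧸ p.1.1) = Nat.card M * Nat.card N := by
  obtain ⟨⟨K, K'⟩, hle, ⟨e₂⟩, ⟨e₁⟩⟩ := p
  have E₁ := comapQuotKerEquiv K.mkQ K.mkQ_surjective (K'.map K.mkQ)
  have hcm : (K'.map K.mkQ).comap K.mkQ = K' := by
    rw [Submodule.comap_map_mkQ]
    exact sup_eq_right.mpr hle
  rw [hcm, Submodule.ker_mkQ] at E₁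
  change Nat.card (V ⧸ K) = _
  rw [Submodule.card_eq_card_quotient_mul_card (K'.map K.mkQ),
    Nat.card_congr ((Submodule.quotientQuotientEquivQuotient K K' hle).trans e₂).toEquiv,
    Nat.card_congr (E₁.symm.trans e₁).toEquiv]
  rw [mul_comm]

theorem sum_hall_mul_card_quotType [Fintype F] (m : ℕ) {n : ℕ} (μ ν : PartIdx)
    (h : μ.1 + ν.1 = n) :
    ∑ lam : n.Partition, Nat.card (QuotType F⟦X⟧ (Fin m → F⟦X⟧) (pMod F (idx lam))) *
        hall F (idx lam) μ ν =
      Nat.card (QuotType F⟦X⟧ (Fin m → F⟦X⟧) (pMod F μ)) *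
        Nat.card (QuotType F⟦X⟧ (Fin m → F⟦X⟧) (pMod F ν)) := by
  have : ∀ lam : n.Partition,
      Finite (QuotType F⟦X⟧ (Fin m → F⟦X⟧) (pMod F (idx lam))) := fun lam => finite_quotType
  rw [← card_flagType_eq_mul, card_flagType_eq_sum fun lam : n.Partition => pMod F (idx lam)]
  · rfl
  · exact fun i j hij => eq_of_pMod_equiv hij
  · intro p
    have hc : Nat.card ((Fin m → F⟦X⟧) ⧸ p.1.1) = Fintype.card F ^ n := by
      rw [card_eq_of_flag p, card_pMod, card_pMod, ← pow_add, h]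
    have : Finite ((Fin m → F⟦X⟧) ⧸ p.1.1) := by
      apply Nat.finite_of_card_ne_zero
      rw [hc]
      exact pow_ne_zero _ Fintype.card_ne_zero
    exact exists_pMod_equiv _ hc
  · rintro ⟨K, ⟨e⟩⟩
    have : Finite ((Fin m → F⟦X⟧) ⧸ K) := Finite.of_equiv _ e.symm.toEquiv
    exact nonempty_submodule_equiv_of_finite_quotient K

theorem aut_ne_zero [Finite F] (L : PartIdx) : (aut F L : ℂ) ≠ 0 := by
  have : Finite (pMod F L ≃ₗ[F⟦X⟧] pMod F L) := DFunLike.finite _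
  have h : aut F L ≠ 0 := Nat.card_pos.ne'
  exact_mod_cast h

/-- The polynomial `∏_{s<l} (1 - q^s x)`. -/
noncomputable def surjPoly (q : ℂ) (l : ℕ) : Polynomial ℂ :=
  ∏ s ∈ Finset.range l, (1 - Polynomial.C (q ^ s) * Polynomial.X)

theorem card_quotType_mul_aut [Fintype F] {m : ℕ} (L : PartIdx) (h : L.1 ≤ m) :
    (Nat.card (QuotType F⟦X⟧ (Fin m → F⟦X⟧) (pMod F L)) : ℂ) * aut F L =
      ((Fintype.card F : ℂ) ^ m) ^ L.1 *
        (surjPoly (Fintype.card F) L.2.parts.card).eval ((Fintype.card F : ℂ) ^ m)⁻¹ := by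
  have hlen : (partList L).length = L.2.parts.card := Multiset.length_sort _
  have h1 := card_surjective_pi_cyc (F := F) (m := m)
    (hlen.le.trans ((card_parts_le L).trans h)) (partList_get_pos L)
  rw [sum_partList_get] at h1
  have h2 : Nat.card {f : (Fin m → F⟦X⟧) →ₗ[F⟦X⟧] (∀ i, Cyc F ((partList L).get i)) //
      Function.Surjective f} =
      Nat.card {f : (Fin m → F⟦X⟧) →ₗ[F⟦X⟧] pMod F L // Function.Surjective f} := by
    refine Nat.card_congr (((pModEquiv F L).symm.congrRight).toEquiv.subtypeEquiv fun f => ?_)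
    exact (EquivLike.comp_surjective f (pModEquiv F L).symm).symm
  rw [h2, card_surjective_eq, Nat.cast_mul] at h1
  unfold aut surjPoly
  rw [h1, hlen, Polynomial.eval_prod]
  simp

theorem surjPoly_identity [Fintype F] {n : ℕ} (μ ν : PartIdx) (h : μ.1 + ν.1 = n) :
    ∑ lam : n.Partition, Polynomial.C ((hall F (idx lam) μ ν : ℂ) / aut F (idx lam)) *
        surjPoly (Fintype.card F) lam.parts.card =
      Polynomial.C ((aut F μ : ℂ) * aut F ν)⁻¹ *
        (surjPoly (Fintype.card F) μ.2.parts.card * surjPoly (Fintype.card F) ν.2.parts.card) := by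
  have hq : (Fintype.card F : ℂ) ≠ 0 := by exact_mod_cast Fintype.card_ne_zero
  apply Polynomial.eq_of_infinite_eval_eq
  refine Set.Infinite.mono (s := Set.range fun m : ℕ => ((Fintype.card F : ℂ) ^ (m + n))⁻¹) ?_ ?_
  · rintro _ ⟨m, rfl⟩
    set x := ((Fintype.card F : ℂ) ^ (m + n))⁻¹ with hx
    have hx0 : (Fintype.card F : ℂ) ^ (m + n) ≠ 0 := pow_ne_zero _ hq
    have key : ∀ L : PartIdx, L.1 ≤ n →
        (surjPoly (Fintype.card F) L.2.parts.card).eval x =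
          (Nat.card (QuotType F⟦X⟧ (Fin (m + n) → F⟦X⟧) (pMod F L)) : ℂ) * aut F L * x ^ L.1 := by
      intro L hL
      rw [card_quotType_mul_aut L (hL.trans (Nat.le_add_left _ _)), mul_right_comm, ← mul_pow,
        hx, mul_inv_cancel₀ hx0, one_pow, one_mul]
    have hid := congrArg (Nat.cast : ℕ → ℂ) (sum_hall_mul_card_quotType (F := F) (m + n) μ ν h)
    push_cast at hid
    simp only [Set.mem_ofPred_eq, Polynomial.eval_finsetSum, Polynomial.eval_mul, Polynomial.eval_C]
    rw [key μ (by omega), key ν (by omega)]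
    have hμ := aut_ne_zero (F := F) μ
    have hν := aut_ne_zero (F := F) ν
    have hrhs : ∀ a b : ℂ, ((aut F μ : ℂ) * aut F ν)⁻¹ *
        (a * aut F μ * x ^ μ.1 * (b * aut F ν * x ^ ν.1)) = a * b * x ^ n := by
      intro a b
      rw [← h, pow_add]
      field_simp
    rw [hrhs, ← hid, Finset.sum_mul]
    refine Finset.sum_congr rfl fun lam _ => ?_
    have hlam : (surjPoly (Fintype.card F) lam.parts.card).eval x =
        (Nat.card (QuotType F⟦X⟧ (Fin (m + n) → F⟦X⟧) (pMod F (idx lam))) : ℂ) *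
          aut F (idx lam) * x ^ n := key (idx lam) le_rfl
    rw [← hx, hlam]
    have := aut_ne_zero (F := F) (idx lam)
    field_simp
  · refine Set.infinite_range_of_injective fun a b hab => ?_
    have h1 := inv_injective hab
    have h2 : Fintype.card F ^ (a + n) = Fintype.card F ^ (b + n) := by exact_mod_cast h1
    exact Nat.add_right_cancel (Nat.pow_right_injective Fintype.one_lt_card h2)

/-- The coefficient of `[I_λ]` in `p_n`, extended by zero to the empty partition. -/
noncomputable def primCoeff (q : ℂ) (l : ℕ) : ℂ :=
  if l = 0 then 0 else ∏ s ∈ Finset.Icc 1 (l - 1), (1 - q ^ s)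

theorem eval_one_surjPoly (q : ℂ) (l : ℕ) :
    (surjPoly q l).eval 1 = if l = 0 then 1 else 0 := by
  cases l with
  | zero => simp [surjPoly]
  | succ l => simp [surjPoly, Finset.prod_range_succ']

theorem eval_one_derivative_surjPoly (q : ℂ) (l : ℕ) :
    (Polynomial.derivative (surjPoly q l)).eval 1 = -primCoeff q l := by
  cases l with
  | zero => simp [surjPoly, primCoeff]
  | succ l =>
    have : ∏ s ∈ Finset.Icc 1 l, (1 - q ^ s) = ∏ s ∈ Finset.range l, (1 - q ^ (s + 1)) := by
      rw [Finset.range_eq_Ico, Finset.prod_Ico_add' (fun s => 1 - q ^ s) 0 l 1]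
      rfl
    simp [surjPoly, Finset.prod_range_succ', primCoeff, Polynomial.eval_prod, this]

theorem sum_primCoeff_hall [Fintype F] {n : ℕ} (μ ν : PartIdx) (h : μ.1 + ν.1 = n) :
    ∑ lam : n.Partition, primCoeff (Fintype.card F) lam.parts.card *
        ((aut F μ : ℂ) * aut F ν / aut F (idx lam) * hall F (idx lam) μ ν) =
      primCoeff (Fintype.card F) μ.2.parts.card * (if ν.2.parts.card = 0 then 1 else 0) +
        (if μ.2.parts.card = 0 then 1 else 0) * primCoeff (Fintype.card F) ν.2.parts.card := by
  have hid := congrArg (fun p => (Polynomial.derivative p).eval 1)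
    (surjPoly_identity (F := F) μ ν h)
  simp only [Polynomial.derivative_sum, Polynomial.derivative_mul, Polynomial.derivative_C,
    zero_mul, zero_add, Polynomial.eval_finsetSum, Polynomial.eval_mul, Polynomial.eval_C, Polynomial.eval_add,
    eval_one_surjPoly, eval_one_derivative_surjPoly] at hid
  have hμ := aut_ne_zero (F := F) μ
  have hν := aut_ne_zero (F := F) ν
  have hid' := congrArg (fun z => -((aut F μ : ℂ) * aut F ν) * z) hid
  simp only [Finset.mul_sum] at hid'
  convert hid' using 1
  · refine Finset.sum_congr rfl fun lam _ => ?_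
    ring
  · field_simp
    ring

end Partitions

section Assembly

/-- The basis vector `[I_L]`. -/
noncomputable def basisVec (L : PartIdx) : H := Finsupp.single L 1

theorem comul_basisVec (F : Type) [Field F] (L : PartIdx) :
    comul F (basisVec L) = comulVal F L := by
  unfold comul basisVec
  erw [Finsupp.lsum_single]
  simp

/-- The projection of the sum of all basis vectors of degree `d` to the span of the unit. -/
noncomputable def unitPart (d : ℕ) : H :=
  ∑ ν : d.Partition, (if ν.parts.card = 0 then (1 : ℂ) else 0) • basisVec (idx ν)

/-- The element `p_d`, with the convention that `p_0 = 0`. -/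
noncomputable def primPart (q : ℂ) (d : ℕ) : H :=
  ∑ μ : d.Partition, primCoeff q μ.parts.card • basisVec (idx μ)

theorem card_parts_ne_zero {n : ℕ} (hn : n ≠ 0) (lam : n.Partition) : lam.parts.card ≠ 0 := by
  intro h
  apply hn
  rw [← lam.parts_sum, Multiset.card_eq_zero.mp h, Multiset.sum_zero]

theorem unitPart_zero : unitPart 0 = one := by
  unfold unitPart
  rw [Fintype.sum_subsingleton _ (Nat.Partition.indiscrete 0), if_pos (by simp), one_smul]
  rfl

theorem unitPart_of_ne_zero {d : ℕ} (hd : d ≠ 0) : unitPart d = 0 :=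
  Finset.sum_eq_zero fun ν _ => by rw [if_neg (card_parts_ne_zero hd ν), zero_smul]

theorem pElt_eq_primPart (F : Type) [Field F] [Fintype F] {n : ℕ} (hn : n ≠ 0) :
    pElt F n = primPart (Fintype.card F) n := by
  unfold pElt primPart
  refine Finset.sum_congr rfl fun lam _ => ?_
  rw [primCoeff, if_neg (card_parts_ne_zero hn lam)]
  rfl

theorem comul_primPart (F : Type) [Field F] [Fintype F] (n : ℕ) :
    comul F (primPart (Fintype.card F) n) =
      ∑ k ∈ Finset.range (n + 1),
        (primPart (Fintype.card F) k ⊗ₜ[ℂ] unitPart (n - k) +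
          unitPart k ⊗ₜ[ℂ] primPart (Fintype.card F) (n - k)) := by
  have hval : ∀ lam : n.Partition, comulVal F (idx lam) =
      ∑ k ∈ Finset.range (n + 1), ∑ μ : k.Partition, ∑ ν : (n - k).Partition,
        ((aut F (idx μ) : ℂ) * aut F (idx ν) / aut F (idx lam) * hall F (idx lam) (idx μ) (idx ν)) •
          (basisVec (idx μ) ⊗ₜ[ℂ] basisVec (idx ν)) := fun lam => rfl
  conv_lhs => unfold primPart
  simp only [map_sum, map_smul, comul_basisVec, hval, Finset.smul_sum]
  rw [Finset.sum_comm]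
  refine Finset.sum_congr rfl fun k hk => ?_
  have hkn : k + (n - k) = n := Nat.add_sub_cancel' (Nat.lt_succ_iff.mp (Finset.mem_range.mp hk))
  rw [Finset.sum_comm]
  unfold primPart unitPart
  rw [TensorProduct.sum_tmul, TensorProduct.sum_tmul]
  simp only [TensorProduct.tmul_sum, TensorProduct.smul_tmul_smul]
  rw [← Finset.sum_add_distrib]
  refine Finset.sum_congr rfl fun μ _ => ?_
  rw [Finset.sum_comm, ← Finset.sum_add_distrib]
  refine Finset.sum_congr rfl fun ν _ => ?_
  simp only [smul_smul]
  rw [← Finset.sum_smul, sum_primCoeff_hall (idx μ) (idx ν) hkn, add_smul]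
  rfl

end Assembly

/-- In the classical Hall algebra of finite `F_q[[T]]`-modules,
for every `n ≥ 1` the element `p_n = ∑_{λ⊢n} (∏_{s=1}^{ℓ(λ)-1}(1-q^s)) [I_λ]` is
primitive: `Δ(p_n) = p_n ⊗ 1 + 1 ⊗ p_n`. -/
theorem pElt_primitive (F : Type) [Field F] [Fintype F] (n : ℕ) (hn : 1 ≤ n) :
    comul F (pElt F n) = pElt F n ⊗ₜ[ℂ] one + one ⊗ₜ[ℂ] pElt F n := by
  have hn0 : n ≠ 0 := Nat.one_le_iff_ne_zero.mp hn
  rw [pElt_eq_primPart F hn0, comul_primPart, Finset.sum_add_distrib]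
  congr 1
  · rw [Finset.sum_eq_single n]
    · rw [Nat.sub_self, unitPart_zero]
    · intro k hk hkn
      have : n - k ≠ 0 := by
        have := Finset.mem_range.mp hk
        omega
      rw [unitPart_of_ne_zero this, TensorProduct.tmul_zero]
    · simp
  · rw [Finset.sum_eq_single 0]
    · rw [Nat.sub_zero, unitPart_zero]
    · intro k _ hk
      rw [unitPart_of_ne_zero hk, TensorProduct.zero_tmul]
    · simp

end ClassicalHall
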